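/- arXiv:math/0211324 — 2 statements merged into one kernel-verified Lean document; each statement's English description precedes it below -/
import Mathlib

section
/- Assume f is proper and s-regular, let 1 ≤ i ≤ s, and assume i < m or d_m ≥ 2. Then K_{i−1} = {z ∈ ℂ^k : liminf_n G_{i,n}(z) < ∞} = {z ∈ ℂ^k : there exists c > 0 such that |f^n(z)| ≤ c^{d_i^n}·max(|z|^{d_i^n}, 1) for all n ≥ 0}; moreover, for every z ∉ K_{i−1} one has G_{i,n}(z) → ∞. -/
open MvPolynomial Filter Topology Metric Set

noncomputable section

def logPlus (x : ℝ) : ℝ := max (Real.log x) 0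

/-- The top-degree homogeneous part of the `j`-th coordinate polynomial of `P`. -/
def pPlus (k : ℕ) (P : Fin k → MvPolynomial (Fin k) ℂ) (j : Fin k) :
    MvPolynomial (Fin k) ℂ :=
  homogeneousComponent (P j).totalDegree (P j)

/-- `Σ_i`: unit-sphere slice of the affine cone over the attracting set `X_i` at
infinity: `‖w‖ = 1`, `P⁺_{(1)}(w) = ⋯ = P⁺_{(i−1)}(w) = 0` and `w_{(>i)} = 0`. -/
def sigmaSet (k : ℕ) (P : Fin k → MvPolynomial (Fin k) ℂ) (l : ℕ → ℕ) (i : ℕ) :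
    Set (EuclideanSpace ℂ (Fin k)) :=
  {w | ‖w‖ = 1 ∧ (∀ j : Fin k, (j : ℕ) < l (i - 1) → eval (fun t => w t) (pPlus k P j) = 0) ∧
    ∀ j : Fin k, l i ≤ (j : ℕ) → w j = 0}

/-- `U_i`: basin of the attracting set `X_i` at infinity. -/
def basin (k : ℕ) (f : EuclideanSpace ℂ (Fin k) → EuclideanSpace ℂ (Fin k))
    (P : Fin k → MvPolynomial (Fin k) ℂ) (l : ℕ → ℕ) (i : ℕ) :
    Set (EuclideanSpace ℂ (Fin k)) :=
  {z | Tendsto (fun n => ‖f^[n] z‖) atTop atTop ∧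
    Tendsto (fun n => infDist (‖f^[n] z‖⁻¹ • f^[n] z) (sigmaSet k P l i)) atTop (𝓝 0)}

/-- `K_i = K_{i−1} \ U_i` (with `K_0 = ℂ^k`), unfolded as the complement of
`U_1 ∪ ⋯ ∪ U_i`. -/
def kSet (k : ℕ) (f : EuclideanSpace ℂ (Fin k) → EuclideanSpace ℂ (Fin k))
    (P : Fin k → MvPolynomial (Fin k) ℂ) (l : ℕ → ℕ) (i : ℕ) :
    Set (EuclideanSpace ℂ (Fin k)) :=
  {z | ∀ j : ℕ, 1 ≤ j → j ≤ i → z ∉ basin k f P l j}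

/-- Euclidean norm of the sub-vector of the coordinates `a ≤ j < b`. -/
def blockNorm (k : ℕ) (z : EuclideanSpace ℂ (Fin k)) (a b : ℕ) : ℝ :=
  Real.sqrt (∑ j : Fin k, if a ≤ (j : ℕ) ∧ (j : ℕ) < b then ‖z j‖ ^ 2 else 0)

end

theorem height_ker_eval_zero_ge (k r : ℕ) (hr : r ≤ k) :
    ∃ I : Ideal (MvPolynomial (Fin k) ℂ), I.IsPrime ∧ (r : ℕ∞) ≤ I.height ∧
      I = RingHom.ker (aeval (fun t : Fin k => if (t : ℕ) < r then 0 else X t) :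
        MvPolynomial (Fin k) ℂ →ₐ[ℂ] MvPolynomial (Fin k) ℂ) := by
  induction r with
  | zero => exact ⟨_, RingHom.ker_isPrime _, by simp, rfl⟩
  | succ r ih =>
    obtain ⟨I, hI, hIh, hIe⟩ := ih (by omega)
    refine ⟨_, RingHom.ker_isPrime _, ?_, rfl⟩
    set J := RingHom.ker (aeval (fun t : Fin k => if (t : ℕ) < r + 1 then 0 else X t) :
        MvPolynomial (Fin k) ℂ →ₐ[ℂ] MvPolynomial (Fin k) ℂ) with hJ
    have hJp : J.IsPrime := RingHom.ker_isPrime _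
    have hlt : I < J := by
      refine lt_of_le_of_ne ?_ ?_
      · intro p hp
        rw [hIe, RingHom.mem_ker] at hp
        rw [hJ, RingHom.mem_ker]
        have := congrArg (aeval (fun t : Fin k => if (t : ℕ) < r + 1 then 0 else X t) :
          MvPolynomial (Fin k) ℂ →ₐ[ℂ] MvPolynomial (Fin k) ℂ) hp
        rw [map_zero] at this
        refine Eq.trans ?_ this
        rw [← AlgHom.comp_apply]
        congr 1
        ext1 t
        by_cases h : (t : ℕ) < r
        · simp [h, h.le]
        · simp [h]
      · intro h
        have h1 : (X ⟨r, hr⟩ : MvPolynomial (Fin k) ℂ) ∈ J := by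
          rw [hJ, RingHom.mem_ker]; simp
        rw [← h, hIe, RingHom.mem_ker] at h1
        simp at h1
    have := Ideal.height_add_one_le_of_lt_of_isPrime hlt
    push_cast
    exact (by gcongr : (r : ℕ∞) + 1 ≤ I.height + 1).trans this

theorem exists_ne_zero_common_zero {k : ℕ} (S : Finset (MvPolynomial (Fin k) ℂ))
    (hcard : S.card < k) (h0 : ∀ p ∈ S, eval 0 p = 0) :
    ∃ x : Fin k → ℂ, x ≠ 0 ∧ ∀ p ∈ S, eval x p = 0 := by
  by_contra! hne
  have hz : zeroLocus ℂ (Ideal.span (S : Set (MvPolynomial (Fin k) ℂ))) = {0} := by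
    rw [zeroLocus_span]
    ext x
    simp only [Set.mem_ofPred_eq, Set.mem_singleton_iff, Finset.mem_coe]
    constructor
    · intro h
      by_contra hx
      obtain ⟨p, hp, hp'⟩ := hne x hx
      exact hp' (by simpa [aeval_eq_eval] using h p hp)
    · rintro rfl p hp
      simpa [aeval_eq_eval] using h0 p hp
  have hrad := vanishingIdeal_zeroLocus_eq_radical (K := ℂ) (Ideal.span (S : Set (MvPolynomial (Fin k) ℂ)))
  rw [hz] at hrad
  obtain ⟨I, hI, hIh, hIe⟩ := height_ker_eval_zero_ge k k le_rfl
  have hIv : I = vanishingIdeal ℂ {(0 : Fin k → ℂ)} := by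
    ext p
    rw [hIe, RingHom.mem_ker, mem_vanishingIdeal_singleton_iff]
    have : (aeval (fun t : Fin k => if (t : ℕ) < k then 0 else X t) :
        MvPolynomial (Fin k) ℂ →ₐ[ℂ] MvPolynomial (Fin k) ℂ) =
        (Algebra.ofId ℂ (MvPolynomial (Fin k) ℂ)).comp (aeval (0 : Fin k → ℂ)) := by
      ext t; simp
    rw [this]
    simp [Algebra.ofId_apply]
  have hmin : I ∈ (Ideal.span (S : Set (MvPolynomial (Fin k) ℂ))).minimalPrimes := by
    rw [← Ideal.radical_minimalPrimes, ← hrad, ← hIv, Ideal.minimalPrimes_eq_subsingleton_self]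
    exact rfl
  have := hIh.trans (Ideal.height_le_card_of_mem_minimalPrimes_span_finset hmin)
  exact absurd (Nat.cast_le.mp this) (by omega)

theorem tendsto_inv_pow_mul_logPlus {a : ℕ → ℝ} {c : ℝ} {D e : ℕ} (hc : 0 < c) (hD : 2 ≤ D)
    (he : 1 ≤ e) (heD : e < D) (ha : Tendsto a atTop atTop)
    (hgrow : ∀ᶠ n in atTop, c * a n ^ D ≤ a (n + 1)) :
    Tendsto (fun n : ℕ => ((e : ℝ) ^ n)⁻¹ * max (Real.log (a n)) 0) atTop atTop := by
  set c' := min c 1 with hc'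
  have hc_pos : 0 < c' := lt_min hc one_pos
  have hc_le_one : c' ≤ 1 := min_le_right _ _
  obtain ⟨N, hN⟩ := eventually_atTop.1 (hgrow.and
    (ha.eventually_ge_atTop (Real.exp 1 / c')))
  have hpos : ∀ n, N ≤ n → 0 < a n := fun n hn =>
    lt_of_lt_of_le (by positivity) (hN n hn).2
  have hstep : ∀ n, N ≤ n → (c' * a n) ^ D ≤ c' * a (n + 1) := by
    intro n hn
    have h1 := (hN n hn).1
    have h2 : c' ^ D ≤ c' * c := by
      calc c' ^ D ≤ c' ^ 2 := pow_le_pow_of_le_one hc_pos.le hc_le_one hD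
        _ = c' * c' := sq c'
        _ ≤ c' * c := by gcongr; exact min_le_left _ _
    calc (c' * a n) ^ D = c' ^ D * a n ^ D := mul_pow _ _ _
      _ ≤ c' * c * a n ^ D := by
        have := hpos n hn
        gcongr
      _ = c' * (c * a n ^ D) := by ring
      _ ≤ c' * a (n + 1) := by gcongr
  have hlog : ∀ m, (D : ℝ) ^ m ≤ Real.log (c' * a (m + N)) := by
    intro m
    induction m with
    | zero =>
      rw [pow_zero, Real.le_log_iff_exp_le (mul_pos hc_pos (hpos _ (by omega)))]
      have := (hN (0 + N) (by omega)).2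
      rwa [div_le_iff₀' hc_pos] at this
    | succ m ih =>
      have h1 := hstep (m + N) (by omega)
      have h0 := mul_pos hc_pos (hpos (m + N) (by omega))
      have h2 := Real.log_le_log (by positivity) h1
      rw [Real.log_pow] at h2
      rw [show m + 1 + N = m + N + 1 by ring]
      refine le_trans ?_ h2
      rw [pow_succ']
      gcongr
  rw [← tendsto_add_atTop_iff_nat N]
  have he0 : (0 : ℝ) < e := by exact_mod_cast he
  have hlim : Tendsto (fun m : ℕ => ((e : ℝ) ^ N)⁻¹ * ((D : ℝ) / e) ^ m) atTop atTop := by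
    refine Tendsto.const_mul_atTop (by positivity) (tendsto_pow_atTop_atTop_of_one_lt ?_)
    rw [one_lt_div he0]
    exact_mod_cast heD
  refine tendsto_atTop_mono (fun m => ?_) hlim
  have h1 : (D : ℝ) ^ m ≤ Real.log (a (m + N)) := by
    refine (hlog m).trans (Real.log_le_log (mul_pos hc_pos (hpos _ (by omega))) ?_)
    have := hpos (m + N) (by omega)
    nlinarith
  calc ((e : ℝ) ^ N)⁻¹ * ((D : ℝ) / e) ^ m = ((e : ℝ) ^ (m + N))⁻¹ * (D : ℝ) ^ m := by
        rw [div_pow, pow_add]; field_simp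
    _ ≤ _ := by gcongr; exact h1.trans (le_max_left _ _)

theorem le_pow_pow_of_succ_le {a : ℕ → ℝ} {C : ℝ} {D : ℕ} (hC : 1 ≤ C) (hD : 2 ≤ D)
    (hgrow : ∀ n, a (n + 1) ≤ C * max (a n) 1 ^ D) (n : ℕ) :
    C * max (a n) 1 ≤ (C * max (a 0) 1) ^ D ^ n := by
  induction n with
  | zero => simp
  | succ n ih =>
    have h1 : (1 : ℝ) ≤ max (a n) 1 := le_max_right _ _
    have h2 : max (a (n + 1)) 1 ≤ C * max (a n) 1 ^ D :=
      max_le (hgrow n) (one_le_mul_of_one_le_of_one_le hC (one_le_pow₀ h1))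
    calc C * max (a (n + 1)) 1 ≤ C * (C * max (a n) 1 ^ D) := by gcongr
      _ = C ^ 2 * max (a n) 1 ^ D := by ring
      _ ≤ C ^ D * max (a n) 1 ^ D := by gcongr
      _ = (C * max (a n) 1) ^ D := (mul_pow _ _ _).symm
      _ ≤ ((C * max (a 0) 1) ^ D ^ n) ^ D := by gcongr
      _ = _ := by rw [← pow_mul, ← pow_succ]

theorem exists_pos_le_of_isCompact {X : Type*} [TopologicalSpace X] {K : Set X} {g : X → ℝ}
    (hK : IsCompact K) (hg : Continuous g) (hpos : ∀ x ∈ K, 0 < g x) :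
    ∃ ε > 0, ∀ x ∈ K, ε ≤ g x := by
  rcases K.eq_empty_or_nonempty with rfl | hne
  · exact ⟨1, one_pos, by simp⟩
  · obtain ⟨x, hx, hmin⟩ := hK.exists_isMinOn hne hg.continuousOn
    exact ⟨g x, hpos x hx, fun y hy => hmin hy⟩

theorem exists_norm_eval_le {k : ℕ} (p : MvPolynomial (Fin k) ℂ) {D : ℕ}
    (hp : p.totalDegree ≤ D) :
    ∃ C : ℝ, 0 ≤ C ∧ ∀ z : EuclideanSpace ℂ (Fin k),
      ‖eval (fun t => z t) p‖ ≤ C * max ‖z‖ 1 ^ D := by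
  refine ⟨∑ s ∈ p.support, ‖coeff s p‖, by positivity, fun z => ?_⟩
  rw [eval_eq, Finset.sum_mul]
  refine (norm_sum_le _ _).trans (Finset.sum_le_sum fun s hs => ?_)
  rw [norm_mul, norm_prod]
  gcongr
  calc ∏ i ∈ s.support, ‖z i ^ s i‖ ≤ ∏ i ∈ s.support, max ‖z‖ 1 ^ s i := by
        gcongr with i hi
        rw [norm_pow]
        gcongr
        exact (PiLp.norm_apply_le z i).trans (le_max_left _ _)
    _ = max ‖z‖ 1 ^ (∑ i ∈ s.support, s i) := Finset.prod_pow_eq_pow_sum _ _ _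
    _ ≤ max ‖z‖ 1 ^ D := by
        gcongr
        · exact le_max_right _ _
        · exact (le_totalDegree hs).trans hp

theorem MvPolynomial.IsHomogeneous.eval_const_mul {k n : ℕ} {p : MvPolynomial (Fin k) ℂ}
    (hp : p.IsHomogeneous n) (c : ℂ) (x : Fin k → ℂ) :
    eval (fun t => c * x t) p = c ^ n * eval x p := by
  rw [eval_eq', eval_eq', Finset.mul_sum]
  refine Finset.sum_congr rfl fun s hs => ?_
  have h : ∑ i, s i = n := by
    have := hp (mem_support_iff.1 hs)
    simpa [Finsupp.weight_apply, Finsupp.sum_fintype] using this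
  simp_rw [mul_pow]
  rw [Finset.prod_mul_distrib, Finset.prod_pow_eq_pow_sum, h]
  ring

theorem totalDegree_sub_homogeneousComponent_le {k : ℕ} (p : MvPolynomial (Fin k) ℂ) :
    (p - homogeneousComponent p.totalDegree p).totalDegree ≤ p.totalDegree - 1 := by
  have h : p - homogeneousComponent p.totalDegree p =
      ∑ i ∈ Finset.range p.totalDegree, homogeneousComponent i p := by
    have := sum_homogeneousComponent p
    rw [Finset.sum_range_succ] at this
    exact sub_eq_of_eq_add this.symm
  rw [h]
  refine (totalDegree_finsetSum_le fun i hi => ?_)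
  have := Finset.mem_range.1 hi
  exact (homogeneousComponent_isHomogeneous i p).totalDegree_le.trans (by omega)

theorem pPlus_isHomogeneous (k : ℕ) (P : Fin k → MvPolynomial (Fin k) ℂ) (j : Fin k) :
    (pPlus k P j).IsHomogeneous (P j).totalDegree :=
  homogeneousComponent_isHomogeneous _ _

theorem continuous_eval_coord {k : ℕ} (p : MvPolynomial (Fin k) ℂ) :
    Continuous fun w : EuclideanSpace ℂ (Fin k) => eval (fun t => w t) p :=
  (continuous_eval p).comp (by fun_prop)

theorem eval_pPlus_unit (k : ℕ) (P : Fin k → MvPolynomial (Fin k) ℂ) (j : Fin k)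
    (y : EuclideanSpace ℂ (Fin k)) :
    eval (fun t => (‖y‖⁻¹ • y) t) (pPlus k P j) =
      ((‖y‖⁻¹ : ℝ) : ℂ) ^ (P j).totalDegree * eval (fun t => y t) (pPlus k P j) := by
  rw [← (pPlus_isHomogeneous k P j).eval_const_mul]
  simp

theorem norm_eval_pPlus_unit_le (k : ℕ) (P : Fin k → MvPolynomial (Fin k) ℂ) (j : Fin k)
    (hj : 1 ≤ (P j).totalDegree) :
    ∃ C : ℝ, 0 ≤ C ∧ ∀ y : EuclideanSpace ℂ (Fin k), 1 ≤ ‖y‖ → ∀ D ≤ (P j).totalDegree,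
      ‖eval (fun t => (‖y‖⁻¹ • y) t) (pPlus k P j)‖ ≤
        ‖eval (fun t => y t) (P j)‖ / ‖y‖ ^ D + C / ‖y‖ := by
  obtain ⟨C, hC0, hC⟩ := exists_norm_eval_le _ (totalDegree_sub_homogeneousComponent_le (P j))
  refine ⟨C, hC0, fun y hy D hD => ?_⟩
  have hy0 : 0 < ‖y‖ := by linarith
  have h1 := hC y
  rw [max_eq_left hy, map_sub] at h1
  have h2 : ‖eval (fun t => y t) (pPlus k P j)‖ ≤
      ‖eval (fun t => y t) (P j)‖ + C * ‖y‖ ^ ((P j).totalDegree - 1) := by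
    have := norm_le_norm_add_norm_sub (eval (fun t => y t) (P j)) (eval (fun t => y t) (pPlus k P j))
    exact this.trans (by gcongr; exact h1)
  rw [eval_pPlus_unit, norm_mul, norm_pow, Complex.norm_real, norm_inv, norm_norm, inv_pow,
    ← div_eq_inv_mul]
  have hpow : ‖y‖ ^ (P j).totalDegree = ‖y‖ ^ ((P j).totalDegree - 1) * ‖y‖ := by
    rw [← pow_succ]; congr 1; omega
  calc _ ≤ (‖eval (fun t => y t) (P j)‖ + C * ‖y‖ ^ ((P j).totalDegree - 1)) /
        ‖y‖ ^ (P j).totalDegree := by gcongr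
    _ = ‖eval (fun t => y t) (P j)‖ / ‖y‖ ^ (P j).totalDegree + C / ‖y‖ := by
        rw [add_div]; congr 1; rw [hpow]; field_simp
    _ ≤ _ := by gcongr

noncomputable section

/-- The sum of `‖P⁺_j(w)‖` over the coordinates `j < a`. -/
def headSum (k : ℕ) (P : Fin k → MvPolynomial (Fin k) ℂ) (a : ℕ)
    (w : EuclideanSpace ℂ (Fin k)) : ℝ :=
  ∑ j : Fin k, if (j : ℕ) < a then ‖eval (fun t => w t) (pPlus k P j)‖ else 0

/-- The sum of `‖w_j‖` over the coordinates `j ≥ a`. -/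
def tailSum (k : ℕ) (a : ℕ) (w : EuclideanSpace ℂ (Fin k)) : ℝ :=
  ∑ j : Fin k, if a ≤ (j : ℕ) then ‖w j‖ else 0

end

section

variable {k : ℕ} {P : Fin k → MvPolynomial (Fin k) ℂ} {a b : ℕ}

theorem headSum_nonneg (w : EuclideanSpace ℂ (Fin k)) : 0 ≤ headSum k P a w :=
  Finset.sum_nonneg fun j _ => by split_ifs <;> positivity

theorem tailSum_nonneg (w : EuclideanSpace ℂ (Fin k)) : 0 ≤ tailSum k a w :=
  Finset.sum_nonneg fun j _ => by split_ifs <;> positivity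

theorem continuous_headSum : Continuous (headSum k P a) := by
  refine continuous_finsetSum _ fun j _ => ?_
  split_ifs
  · exact (continuous_eval_coord _).norm
  · exact continuous_const

theorem continuous_tailSum : Continuous (tailSum k a) := by
  refine continuous_finsetSum _ fun j _ => ?_
  split_ifs
  · fun_prop
  · exact continuous_const

theorem eval_pPlus_eq_zero_of_headSum {w : EuclideanSpace ℂ (Fin k)}
    (h : headSum k P a w = 0) (j : Fin k) (hj : (j : ℕ) < a) :
    eval (fun t => w t) (pPlus k P j) = 0 := by
  have := (Finset.sum_eq_zero_iff_of_nonneg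
    (fun j _ => by split_ifs <;> positivity)).1 h j (Finset.mem_univ j)
  simpa [hj] using this

theorem apply_eq_zero_of_tailSum {w : EuclideanSpace ℂ (Fin k)}
    (h : tailSum k a w = 0) (j : Fin k) (hj : a ≤ (j : ℕ)) : w j = 0 := by
  have := (Finset.sum_eq_zero_iff_of_nonneg
    (fun j _ => by split_ifs <;> positivity)).1 h j (Finset.mem_univ j)
  simpa [hj] using this

theorem tailSum_unit (y : EuclideanSpace ℂ (Fin k)) :
    tailSum k a (‖y‖⁻¹ • y) = tailSum k a y / ‖y‖ := by
  rw [tailSum, tailSum, Finset.sum_div]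
  refine Finset.sum_congr rfl fun j _ => ?_
  split_ifs
  · simp [div_eq_inv_mul]
  · simp

/-- The regularity condition at the cutoff `a`. -/
def IsRegularAt (k : ℕ) (P : Fin k → MvPolynomial (Fin k) ℂ) (a : ℕ) : Prop :=
  ∀ z : Fin k → ℂ, (∀ j : Fin k, (j : ℕ) < a → eval z (pPlus k P j) = 0) →
    (∀ j : Fin k, a ≤ (j : ℕ) → z j = 0) → z = 0

theorem IsRegularAt.exists_le (h : IsRegularAt k P a) :
    ∃ ε > 0, ∀ u : EuclideanSpace ℂ (Fin k), ‖u‖ = 1 → ε ≤ headSum k P a u + tailSum k a u := by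
  obtain ⟨ε, hε, H⟩ := exists_pos_le_of_isCompact
    (isCompact_sphere (0 : EuclideanSpace ℂ (Fin k)) 1)
    ((continuous_headSum (P := P) (a := a)).add (continuous_tailSum (a := a))) (fun u hu => by
      have hu1 : ‖u‖ = 1 := by simpa using hu
      have h1 := headSum_nonneg (P := P) (a := a) u
      have h2 := tailSum_nonneg (a := a) u
      by_contra hle
      have h0 := h (fun t => u t) (eval_pPlus_eq_zero_of_headSum (by simp at hle; linarith))
        (apply_eq_zero_of_tailSum (by simp at hle; linarith))
      have : u = 0 := by ext t; exact congrFun h0 t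
      simp [this] at hu1)
  exact ⟨ε, hε, fun u hu => H u (by simpa using hu)⟩

theorem tendsto_infDist_of_headSum_tailSum {u : ℕ → EuclideanSpace ℂ (Fin k)}
    (hu : ∀ᶠ n in atTop, ‖u n‖ = 1)
    (hhead : Tendsto (fun n => headSum k P a (u n)) atTop (𝓝 0))
    (htail : Tendsto (fun n => tailSum k b (u n)) atTop (𝓝 0)) :
    Tendsto (fun n => infDist (u n) {w | ‖w‖ = 1 ∧
      (∀ j : Fin k, (j : ℕ) < a → eval (fun t => w t) (pPlus k P j) = 0) ∧
      ∀ j : Fin k, b ≤ (j : ℕ) → w j = 0}) atTop (𝓝 0) := by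
  set S : Set (EuclideanSpace ℂ (Fin k)) := {w | ‖w‖ = 1 ∧
      (∀ j : Fin k, (j : ℕ) < a → eval (fun t => w t) (pPlus k P j) = 0) ∧
      ∀ j : Fin k, b ≤ (j : ℕ) → w j = 0} with hS
  refine Metric.tendsto_atTop.2 fun ε hε => ?_
  have hc : IsCompact (sphere (0 : EuclideanSpace ℂ (Fin k)) 1 ∩ {w | ε ≤ infDist w S}) :=
    (isCompact_sphere _ _).inter_right
      (isClosed_le continuous_const (continuous_infDist_pt S))
  obtain ⟨δ, hδ, H⟩ := exists_pos_le_of_isCompact hc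
    ((continuous_headSum (P := P) (a := a)).add (continuous_tailSum (a := b)))
    (fun w hw => by
      have hw1 : ‖w‖ = 1 := by simpa using hw.1
      have h1 := headSum_nonneg (P := P) (a := a) w
      have h2 := tailSum_nonneg (a := b) w
      by_contra hle
      have hmem : w ∈ S := ⟨hw1,
        eval_pPlus_eq_zero_of_headSum (by simp at hle; linarith),
        apply_eq_zero_of_tailSum (by simp at hle; linarith)⟩
      have h3 : ε ≤ infDist w S := hw.2
      rw [infDist_zero_of_mem hmem] at h3
      linarith)
  have hsum := hhead.add htail
  rw [add_zero] at hsum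
  obtain ⟨N, hN⟩ := eventually_atTop.1 (hu.and (hsum.eventually_lt_const hδ))
  refine ⟨N, fun n hn => ?_⟩
  obtain ⟨h1, h2⟩ := hN n hn
  rw [Real.dist_eq, sub_zero, abs_of_nonneg infDist_nonneg]
  by_contra hle
  have := H (u n) ⟨by simpa using h1, not_lt.1 hle⟩
  simp only [Pi.add_apply] at this
  linarith

variable {f : EuclideanSpace ℂ (Fin k) → EuclideanSpace ℂ (Fin k)}

theorem exists_growth (hf : ∀ (z : EuclideanSpace ℂ (Fin k)) (j : Fin k),
      f z j = eval (fun t => z t) (P j)) {D : ℕ} (hD : 1 ≤ D)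
    (hdeg : ∀ j : Fin k, (j : ℕ) < a → D ≤ (P j).totalDegree) {ε : ℝ} (hε : 0 < ε) :
    ∃ c > 0, ∃ R ≥ 1, ∀ y, R ≤ ‖y‖ → ε ≤ headSum k P a (‖y‖⁻¹ • y) →
      c * ‖y‖ ^ D ≤ ‖f y‖ := by
  have hex : ∀ j : Fin k, ∃ C : ℝ, 0 ≤ C ∧ ((j : ℕ) < a → ∀ y : EuclideanSpace ℂ (Fin k),
      1 ≤ ‖y‖ → ‖eval (fun t => (‖y‖⁻¹ • y) t) (pPlus k P j)‖ ≤
        ‖f y‖ / ‖y‖ ^ D + C / ‖y‖) := by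
    intro j
    by_cases hj : (j : ℕ) < a
    · obtain ⟨C, hC0, hC⟩ := norm_eval_pPlus_unit_le k P j (hD.trans (hdeg j hj))
      refine ⟨C, hC0, fun _ y hy => (hC y hy D (hdeg j hj)).trans ?_⟩
      rw [← hf]
      gcongr
      exact PiLp.norm_apply_le _ _
    · exact ⟨0, le_rfl, fun h => absurd h hj⟩
  choose C hC0 hC using hex
  have hS0 : 0 ≤ ∑ j, C j := Finset.sum_nonneg fun j _ => hC0 j
  refine ⟨ε / (2 * (k + 1)), by positivity, 1 + 2 * (∑ j, C j) / ε, ?_, fun y hy hle => ?_⟩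
  · have : 0 ≤ 2 * (∑ j, C j) / ε := by positivity
    linarith
  have hq : 0 ≤ 2 * (∑ j, C j) / ε := by positivity
  have hy1 : 1 ≤ ‖y‖ := by linarith
  have hy0 : 0 < ‖y‖ := by linarith
  have h1 : ε ≤ k * (‖f y‖ / ‖y‖ ^ D) + (∑ j, C j) / ‖y‖ := by
    refine hle.trans ?_
    calc headSum k P a (‖y‖⁻¹ • y) ≤ ∑ j, (‖f y‖ / ‖y‖ ^ D + C j / ‖y‖) := by
          refine Finset.sum_le_sum fun j _ => ?_
          split_ifs with hj
          · exact hC j hj y hy1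
          · have := hC0 j
            positivity
      _ = _ := by simp [Finset.sum_add_distrib, Finset.sum_div]
  have h2 : (∑ j, C j) / ‖y‖ ≤ ε / 2 := by
    have : 2 * (∑ j, C j) / ε ≤ ‖y‖ := by linarith
    rw [div_le_iff₀ hε] at this
    rw [div_le_iff₀ hy0]
    linarith
  have h3 : k * (‖f y‖ / ‖y‖ ^ D) ≤ (k + 1) * (‖f y‖ / ‖y‖ ^ D) := by
    gcongr; linarith
  have h4 : ε / 2 ≤ (k + 1) * ‖f y‖ / ‖y‖ ^ D := by
    rw [mul_div_assoc]; linarith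
  rw [le_div_iff₀ (by positivity)] at h4
  rw [div_mul_eq_mul_div, div_le_iff₀ (by positivity)]
  linarith

theorem exists_tailSum_le (hf : ∀ (z : EuclideanSpace ℂ (Fin k)) (j : Fin k),
      f z j = eval (fun t => z t) (P j)) {D : ℕ}
    (hdeg : ∀ j : Fin k, a ≤ (j : ℕ) → (P j).totalDegree ≤ D) :
    ∃ C : ℝ, 0 ≤ C ∧ ∀ y, tailSum k a (f y) ≤ C * max ‖y‖ 1 ^ D := by
  have hex : ∀ j : Fin k, ∃ C : ℝ, 0 ≤ C ∧ (a ≤ (j : ℕ) → ∀ y,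
      ‖f y j‖ ≤ C * max ‖y‖ 1 ^ D) := by
    intro j
    by_cases hj : a ≤ (j : ℕ)
    · obtain ⟨C, hC0, hC⟩ := exists_norm_eval_le (P j) (hdeg j hj)
      exact ⟨C, hC0, fun _ y => by rw [hf]; exact hC y⟩
    · exact ⟨0, le_rfl, fun h => absurd h hj⟩
  choose C hC0 hC using hex
  refine ⟨∑ j, C j, Finset.sum_nonneg fun j _ => hC0 j, fun y => ?_⟩
  rw [Finset.sum_mul]
  refine Finset.sum_le_sum fun j _ => ?_
  split_ifs with hj
  · exact hC j hj y
  · have := hC0 j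
    positivity

/-- An orbit on which the leading forms of index `< a` stay away from `0` at one point far
enough from the origin escapes to infinity towards `{w_j = 0, j ≥ a}`. -/
theorem escape_of_not_tendsto (hf : ∀ (z : EuclideanSpace ℂ (Fin k)) (j : Fin k),
      f z j = eval (fun t => z t) (P j)) (hreg : IsRegularAt k P a) {D : ℕ} (hD : 2 ≤ D)
    (hdeg : ∀ j : Fin k, (j : ℕ) < a → D ≤ (P j).totalDegree)
    (hdeg' : ∀ j : Fin k, a ≤ (j : ℕ) → (P j).totalDegree ≤ D - 1)
    (z : EuclideanSpace ℂ (Fin k))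
    (h : ¬ Tendsto (fun n => headSum k P a (‖f^[n] z‖⁻¹ • f^[n] z))
      (comap (fun n => ‖f^[n] z‖) atTop) (𝓝 0)) :
    Tendsto (fun n => ‖f^[n] z‖) atTop atTop ∧
      Tendsto (fun n => tailSum k a (‖f^[n] z‖⁻¹ • f^[n] z)) atTop (𝓝 0) := by
  obtain ⟨ε₀, hε₀, hreg⟩ := hreg.exists_le
  obtain ⟨ε, hε, hfar⟩ : ∃ ε > 0, ∀ R, ∃ n, R ≤ ‖f^[n] z‖ ∧
      ε ≤ headSum k P a (‖f^[n] z‖⁻¹ • f^[n] z) := by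
    by_contra! hcon
    refine h (Metric.tendsto_nhds.2 fun ε hε => ?_)
    obtain ⟨R, hR⟩ := hcon ε hε
    refine mem_comap.2 ⟨_, Ici_mem_atTop R, fun n hn => ?_⟩
    have := hR n hn
    simpa [Real.dist_eq, abs_of_nonneg (headSum_nonneg _)] using this
  set η := min ε (ε₀ / 2) with hη
  have hη0 : 0 < η := lt_min hε (by positivity)
  obtain ⟨c, hc, R, hR1, hgrow⟩ := exists_growth hf (by omega : 1 ≤ D) hdeg hη0
  obtain ⟨C, hC0, htail⟩ := exists_tailSum_le hf hdeg'
  have htail' : ∀ y, R ≤ ‖y‖ → η ≤ headSum k P a (‖y‖⁻¹ • y) →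
      tailSum k a (‖f y‖⁻¹ • f y) ≤ C / c / ‖y‖ := by
    intro y hy hle
    have h1 := hgrow y hy hle
    have hy1 : 1 ≤ ‖y‖ := by linarith
    have hy0 : 0 < ‖y‖ := by linarith
    have h2 := htail y
    rw [max_eq_left hy1] at h2
    rw [tailSum_unit]
    calc tailSum k a (f y) / ‖f y‖ ≤ C * ‖y‖ ^ (D - 1) / (c * ‖y‖ ^ D) := by gcongr
      _ = C / c / ‖y‖ := by
        have : ‖y‖ ^ D = ‖y‖ ^ (D - 1) * ‖y‖ := by
          rw [← pow_succ]; congr 1; omega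
        rw [this]; field_simp
  set R' := max R (max (2 / c) (2 * (C / c) / ε₀)) with hR'
  have hstep : ∀ y, R' ≤ ‖y‖ → η ≤ headSum k P a (‖y‖⁻¹ • y) →
      2 * ‖y‖ ≤ ‖f y‖ ∧ η ≤ headSum k P a (‖f y‖⁻¹ • f y) := by
    intro y hy hle
    have hyR : R ≤ ‖y‖ := (le_max_left _ _).trans hy
    have hyc : 2 / c ≤ ‖y‖ := ((le_max_left _ _).trans (le_max_right _ _)).trans hy
    have hyC : 2 * (C / c) / ε₀ ≤ ‖y‖ := ((le_max_right _ _).trans (le_max_right _ _)).trans hy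
    have hy1 : 1 ≤ ‖y‖ := by linarith
    have hy0 : 0 < ‖y‖ := by linarith
    have h1 := hgrow y hyR hle
    have h2 : 2 * ‖y‖ ≤ ‖f y‖ := by
      refine le_trans ?_ h1
      rw [div_le_iff₀' hc] at hyc
      calc 2 * ‖y‖ ≤ c * ‖y‖ * ‖y‖ := by gcongr
        _ = c * ‖y‖ ^ 2 := by ring
        _ ≤ c * ‖y‖ ^ D := by gcongr
    refine ⟨h2, ?_⟩
    have hfy : 0 < ‖f y‖ := by linarith
    have h3 := hreg (‖f y‖⁻¹ • f y) (by rw [norm_smul, norm_inv, norm_norm]; field_simp)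
    have h4 := htail' y hyR hle
    have h5 : C / c / ‖y‖ ≤ ε₀ / 2 := by
      rw [div_le_iff₀ hε₀] at hyC
      rw [div_le_iff₀ hy0]
      linarith
    have := min_le_right ε (ε₀ / 2)
    linarith
  obtain ⟨N, hN, hNε⟩ := hfar R'
  have hR_pos : 0 < R' := by linarith [le_max_left R (max (2 / c) (2 * (C / c) / ε₀))]
  have horb : ∀ m, 2 ^ m * R' ≤ ‖f^[m + N] z‖ ∧
      η ≤ headSum k P a (‖f^[m + N] z‖⁻¹ • f^[m + N] z) := by
    intro m
    induction m with
    | zero => simpa using ⟨hN, (min_le_left _ _).trans hNε⟩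
    | succ m ih =>
      rw [show m + 1 + N = (m + N) + 1 by ring, Function.iterate_succ_apply']
      have h1 : R' ≤ ‖f^[m + N] z‖ :=
        (le_mul_of_one_le_left hR_pos.le (one_le_pow₀ one_le_two)).trans ih.1
      obtain ⟨h2, h3⟩ := hstep _ h1 ih.2
      refine ⟨?_, h3⟩
      rw [pow_succ']
      linarith [ih.1]
  have hinf : Tendsto (fun n => ‖f^[n] z‖) atTop atTop := by
    rw [← tendsto_add_atTop_iff_nat N]
    exact tendsto_atTop_mono (fun m => (horb m).1)
      ((tendsto_pow_atTop_atTop_of_one_lt one_lt_two).atTop_mul_const hR_pos)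
  refine ⟨hinf, ?_⟩
  rw [← tendsto_add_atTop_iff_nat (N + 1)]
  have hlim : Tendsto (fun m => C / c / ‖f^[m + N] z‖) atTop (𝓝 0) :=
    ((tendsto_add_atTop_iff_nat N).2 hinf).const_div_atTop _
  refine squeeze_zero (fun m => tailSum_nonneg _) (fun m => ?_) hlim
  rw [show m + (N + 1) = (m + N) + 1 by ring, Function.iterate_succ_apply']
  refine htail' _ ?_ (horb m).2
  exact (le_max_left _ _).trans
    ((le_mul_of_one_le_left hR_pos.le (one_le_pow₀ one_le_two)).trans (horb m).1)

theorem exists_norm_iterate_succ_le (hf : ∀ (z : EuclideanSpace ℂ (Fin k)) (j : Fin k),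
      f z j = eval (fun t => z t) (P j)) (hreg : IsRegularAt k P a) {D : ℕ}
    (hdeg : ∀ j : Fin k, a ≤ (j : ℕ) → (P j).totalDegree ≤ D)
    (z : EuclideanSpace ℂ (Fin k))
    (h : Tendsto (fun n => headSum k P a (‖f^[n] z‖⁻¹ • f^[n] z))
      (comap (fun n => ‖f^[n] z‖) atTop) (𝓝 0)) :
    ∃ C : ℝ, 1 ≤ C ∧ ∀ n, ‖f^[n + 1] z‖ ≤ C * max ‖f^[n] z‖ 1 ^ D := by
  obtain ⟨ε₀, hε₀, hreg⟩ := hreg.exists_le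
  obtain ⟨C, hC0, htail⟩ := exists_tailSum_le hf hdeg
  obtain ⟨s, hs, hsub⟩ := mem_comap.1 (h.eventually_lt_const (half_pos hε₀))
  obtain ⟨R, hR⟩ := mem_atTop_sets.1 hs
  refine ⟨max 1 (max R (2 * C / ε₀)), le_max_left _ _, fun n => ?_⟩
  have hM : 1 ≤ max ‖f^[n] z‖ 1 ^ D := one_le_pow₀ (le_max_right _ _)
  rcases le_total ‖f^[n + 1] z‖ (max 1 R) with hle | hle
  · refine (hle.trans ?_).trans (le_mul_of_one_le_right (by positivity) hM)
    exact max_le_max le_rfl (le_max_left _ _)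
  · have h1 : headSum k P a (‖f^[n + 1] z‖⁻¹ • f^[n + 1] z) < ε₀ / 2 :=
      hsub (hR _ ((le_max_right _ _).trans hle))
    have hpos : 0 < ‖f^[n + 1] z‖ := by linarith [le_max_left 1 R]
    have h2 := hreg (‖f^[n + 1] z‖⁻¹ • f^[n + 1] z)
      (by rw [norm_smul, norm_inv, norm_norm]; field_simp)
    rw [tailSum_unit] at h2
    have h3 : ε₀ / 2 ≤ tailSum k a (f^[n + 1] z) / ‖f^[n + 1] z‖ := by linarith
    rw [le_div_iff₀ hpos] at h3
    have h4 := htail (f^[n] z)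
    rw [← Function.iterate_succ_apply' f n z] at h4
    calc ‖f^[n + 1] z‖ ≤ 2 * C / ε₀ * max ‖f^[n] z‖ 1 ^ D := by
          rw [div_mul_eq_mul_div, le_div_iff₀ hε₀]
          linarith
      _ ≤ _ := by
          gcongr
          exact (le_max_right _ _).trans (le_max_right _ _)

end

theorem IsRegularAt.eventually_le_headSum {k : ℕ} {P : Fin k → MvPolynomial (Fin k) ℂ} {b : ℕ}
    (hreg : IsRegularAt k P b) {S : Set (EuclideanSpace ℂ (Fin k))} (hne : S.Nonempty)
    (hS : ∀ w ∈ S, ∀ j : Fin k, b ≤ (j : ℕ) → w j = 0) {u : ℕ → EuclideanSpace ℂ (Fin k)}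
    (hu : ∀ᶠ n in atTop, ‖u n‖ = 1) (h : Tendsto (fun n => infDist (u n) S) atTop (𝓝 0)) :
    ∃ ε > 0, ∀ᶠ n in atTop, ε ≤ headSum k P b (u n) := by
  obtain ⟨ε, hε, H⟩ := hreg.exists_le
  refine ⟨ε / 2, half_pos hε, ?_⟩
  have htail : ∀ w, tailSum k b w ≤ k * infDist w S := by
    intro w
    have hco : ∀ j : Fin k, b ≤ (j : ℕ) → ‖w j‖ ≤ infDist w S := by
      intro j hj
      refine (le_infDist hne).2 fun v hv => ?_
      have := PiLp.norm_apply_le (w - v) j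
      rwa [PiLp.sub_apply, hS v hv j hj, sub_zero, ← dist_eq_norm] at this
    calc tailSum k b w ≤ ∑ _j : Fin k, infDist w S := by
          refine Finset.sum_le_sum fun j _ => ?_
          split_ifs with hj
          · exact hco j hj
          · exact infDist_nonneg
      _ = _ := by simp
  have hlim := h.const_mul (k : ℝ)
  rw [mul_zero] at hlim
  filter_upwards [hu, hlim.eventually_lt_const (half_pos hε)] with n h1 h2
  have := H _ h1
  have := htail (u n)
  linarith

theorem sigmaSet_nonempty {k : ℕ} {P : Fin k → MvPolynomial (Fin k) ℂ} {l : ℕ → ℕ} {i : ℕ}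
    (hdeg : ∀ j, 1 ≤ (P j).totalDegree) (hl : l (i - 1) < l i) (hk : l i ≤ k) :
    (sigmaSet k P l i).Nonempty := by
  classical
  let g : Fin k → MvPolynomial (Fin k) ℂ := fun j => if (j : ℕ) < l (i - 1) then pPlus k P j else X j
  let T : Finset (Fin k) := Finset.univ.filter fun j => (j : ℕ) < l (i - 1) ∨ l i ≤ (j : ℕ)
  have hT : T.card < k := by
    have : (⟨l (i - 1), by omega⟩ : Fin k) ∉ T := by simp [T, hl]
    simpa using Finset.card_lt_univ_of_notMem this
  obtain ⟨x, hx, hzero⟩ := exists_ne_zero_common_zero (T.image g)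
    (Finset.card_image_le.trans_lt hT) (by
      intro p hp
      obtain ⟨j, hj, rfl⟩ := Finset.mem_image.1 hp
      dsimp only [g]
      split_ifs
      · have := (pPlus_isHomogeneous k P j).eval_const_mul 0 0
        rw [zero_pow (by have := hdeg j; omega), zero_mul] at this
        rw [← this]
        congr 2
        ext t; simp
      · simp)
  have hzero' : ∀ j ∈ T, eval x (g j) = 0 := fun j hj => hzero _ (Finset.mem_image_of_mem g hj)
  set y : EuclideanSpace ℂ (Fin k) := WithLp.toLp 2 x with hy
  have hy0 : y ≠ 0 := by
    intro h
    apply hx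
    ext t
    exact congrArg (fun v : EuclideanSpace ℂ (Fin k) => v t) h
  refine ⟨‖y‖⁻¹ • y, ?_, fun j hj => ?_, fun j hj => ?_⟩
  · rw [norm_smul, norm_inv, norm_norm, inv_mul_cancel₀ (norm_ne_zero_iff.2 hy0)]
  · rw [eval_pPlus_unit]
    have := hzero' j (by simp [T, hj])
    simp only [g, hj, if_true] at this
    rw [show (fun t => y t) = x from rfl, this, mul_zero]
  · have := hzero' j (by simp [T, hj])
    have hnot : ¬ (j : ℕ) < l (i - 1) := by omega
    simp only [g, hnot, if_false, eval_X] at this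
    simp [hy, this]

theorem exists_block {l : ℕ → ℕ} (hl0 : l 0 = 0) {t r : ℕ} (ht : t < l r) :
    ∃ j, 1 ≤ j ∧ j ≤ r ∧ l (j - 1) ≤ t ∧ t < l j := by
  induction r with
  | zero => omega
  | succ r ih =>
    by_cases h : t < l r
    · obtain ⟨j, h1, h2, h3⟩ := ih h
      exact ⟨j, h1, by omega, h3⟩
    · exact ⟨r + 1, by omega, le_rfl, by simpa using h, ht⟩

/-- (Theorem 2.1, characterization of `K_{i−1}`.) For a proper
`s`-regular map and `1 ≤ i ≤ s` (with `i < m` or `d_m ≥ 2`): `K_{i−1}` is the set of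
points where `liminf G_{i,n} < ∞`, equivalently where
`‖f^n(z)‖ ≤ c^{d_i^n} max (‖z‖^{d_i^n}) 1` for some `c > 0` and all `n`; and
`G_{i,n}(z) → ∞` for every `z ∉ K_{i−1}`. -/
theorem stmt8 (k m s : ℕ) (hk : 0 < k)
    (l : ℕ → ℕ) (hl0 : l 0 = 0) (hlm : l m = k)
    (hlmono : ∀ i < m, l i < l (i + 1))
    (P : Fin k → MvPolynomial (Fin k) ℂ)
    (d : ℕ → ℕ)
    (hdeg : ∀ i, 1 ≤ i → i ≤ m → ∀ j : Fin k,
      l (i - 1) ≤ (j : ℕ) → (j : ℕ) < l i → (P j).totalDegree = d i)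
    (hdmono : ∀ i, 1 ≤ i → i < m → d (i + 1) < d i)
    (hdm : 1 ≤ d m)
    (f : EuclideanSpace ℂ (Fin k) → EuclideanSpace ℂ (Fin k))
    (hf : ∀ (z : EuclideanSpace ℂ (Fin k)) (j : Fin k),
      f z j = eval (fun t => z t) (P j))
    (hproper : IsProperMap f)
    (hs1 : 1 ≤ s) (hsm : s ≤ m)
    (hreg : ∀ r, 1 ≤ r → r ≤ s → ∀ z : Fin k → ℂ,
      (∀ j : Fin k, (j : ℕ) < l r → eval z (pPlus k P j) = 0) →
      (∀ j : Fin k, l r ≤ (j : ℕ) → z j = 0) → z = 0)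
    (i : ℕ) (hi1 : 1 ≤ i) (his : i ≤ s)
    (hcase : i < m ∨ 2 ≤ d m) :
    kSet k f P l (i - 1) =
      {z | Filter.liminf
        (fun n : ℕ => ((((d i : ℝ) ^ n)⁻¹ * logPlus ‖f^[n] z‖ : ℝ) : EReal)) atTop < ⊤} ∧
    kSet k f P l (i - 1) =
      {z | ∃ c : ℝ, 0 < c ∧ ∀ n : ℕ,
        ‖f^[n] z‖ ≤ c ^ ((d i : ℝ) ^ n) * max (‖z‖ ^ ((d i : ℝ) ^ n)) 1} ∧
    ∀ z, z ∉ kSet k f P l (i - 1) →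
      Tendsto (fun n : ℕ => ((d i : ℝ) ^ n)⁻¹ * logPlus ‖f^[n] z‖) atTop atTop := by
  have hlle : ∀ a b, a ≤ b → b ≤ m → l a ≤ l b := by
    intro a b hab
    induction b, hab using Nat.le_induction with
    | base => exact fun _ => le_rfl
    | succ b _ ih => exact fun hb => (ih (by omega)).trans (hlmono b (by omega)).le
  have hdle : ∀ a b, 1 ≤ a → a ≤ b → b ≤ m → d b ≤ d a := by
    intro a b ha hab
    induction b, hab using Nat.le_induction with
    | base => exact fun _ => le_rfl
    | succ b hb' ih =>
      exact fun hb => (hdmono b (by omega) (by omega)).le.trans (ih (by omega))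
  have hdlt : ∀ a b, 1 ≤ a → a < b → b ≤ m → d b < d a := fun a b ha hab hb =>
    (hdle (a + 1) b (by omega) hab hb).trans_lt (hdmono a ha (by omega))
  have hblock : ∀ j : Fin k, ∃ q, 1 ≤ q ∧ q ≤ m ∧ l (q - 1) ≤ (j : ℕ) ∧ (j : ℕ) < l q ∧
      (P j).totalDegree = d q := by
    intro j
    obtain ⟨q, h1, h2, h3, h4⟩ := exists_block hl0 (hlm ▸ j.2 : (j : ℕ) < l m)
    exact ⟨q, h1, h2, h3, h4, hdeg q h1 h2 j h3 h4⟩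
  have hdegge : ∀ r, r ≤ m → ∀ j : Fin k, (j : ℕ) < l r → d r ≤ (P j).totalDegree := by
    intro r hr j hj
    obtain ⟨q, h1, h2, h3, h4, h5⟩ := hblock j
    rw [h5]
    refine hdle q r h1 ?_ hr
    by_contra hcon
    have := hlle r (q - 1) (by omega) (by omega)
    omega
  have hdegle : ∀ r, r < m → ∀ j : Fin k, l r ≤ (j : ℕ) → (P j).totalDegree ≤ d (r + 1) := by
    intro r hr j hj
    obtain ⟨q, h1, h2, h3, h4, h5⟩ := hblock j
    rw [h5]
    refine hdle (r + 1) q (by omega) ?_ h2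
    by_contra hcon
    have := hlle q r (by omega) hr.le
    omega
  have hdegpos : ∀ j, 1 ≤ (P j).totalDegree := by
    intro j
    obtain ⟨q, h1, h2, h3, h4, h5⟩ := hblock j
    rw [h5]
    exact hdm.trans (hdle q m h1 h2 le_rfl)
  have hdi : 2 ≤ d i := by
    rcases hcase with h | h
    · have := hdlt i m hi1 h le_rfl
      omega
    · exact h.trans (hdle i m hi1 (his.trans hsm) le_rfl)
  have hregular : ∀ r, r ≤ s → IsRegularAt k P (l r) := by
    intro r hr z h1 h2
    rcases Nat.eq_zero_or_pos r with rfl | hpos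
    · ext j
      exact h2 j (by omega)
    · exact hreg r hpos hr z h1 h2
  have hunit : ∀ z, Tendsto (fun n => ‖f^[n] z‖) atTop atTop →
      ∀ᶠ n in atTop, ‖‖f^[n] z‖⁻¹ • f^[n] z‖ = 1 := by
    intro z hz
    filter_upwards [hz.eventually_gt_atTop 0] with n hn
    rw [norm_smul, norm_inv, norm_norm, inv_mul_cancel₀ hn.ne']
  have hnot : ∀ z, z ∉ kSet k f P l (i - 1) →
      Tendsto (fun n : ℕ => ((d i : ℝ) ^ n)⁻¹ * logPlus ‖f^[n] z‖) atTop atTop := by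
    intro z hz
    simp only [kSet, Set.mem_ofPred_eq, not_forall, not_not] at hz
    obtain ⟨j, hj1, hji, hz1, hz2⟩ := hz
    have hlj : l (j - 1) < l j := by
      have := hlmono (j - 1) (by omega)
      rwa [Nat.sub_add_cancel hj1] at this
    obtain ⟨ε, hε, hev⟩ := (hregular j (by omega)).eventually_le_headSum
      (sigmaSet_nonempty hdegpos hlj (hlm ▸ hlle j m (by omega) le_rfl))
      (fun w hw => hw.2.2) (hunit z hz1) hz2
    have hd := hdlt j i hj1 (by omega) (by omega)
    obtain ⟨c, hc, R, -, hgrow⟩ := exists_growth hf (by omega : 1 ≤ d j)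
      (hdegge j (by omega)) hε
    refine tendsto_inv_pow_mul_logPlus hc (by omega) (by omega) hd hz1 ?_
    filter_upwards [hev, hz1.eventually_ge_atTop R] with n h1 h2
    rw [Function.iterate_succ_apply']
    exact hgrow _ h2 h1
  have hsmall : ∀ z ∈ kSet k f P l (i - 1), ∀ r, r ≤ i - 1 →
      Tendsto (fun n => headSum k P (l r) (‖f^[n] z‖⁻¹ • f^[n] z))
        (comap (fun n => ‖f^[n] z‖) atTop) (𝓝 0) := by
    intro z hz r
    induction r with
    | zero => simpa [headSum, hl0] using tendsto_const_nhds
    | succ r ih =>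
      intro hr
      by_contra hcon
      have hd := hdlt (r + 1) i (by omega) (by omega) (by omega)
      obtain ⟨hinf, htail⟩ := escape_of_not_tendsto hf (hregular (r + 1) (by omega))
        (by omega : 2 ≤ d (r + 1)) (hdegge (r + 1) (by omega))
        (fun j hj => by
          have h1 := hdegle (r + 1) (by omega) j hj
          have h2 := hdmono (r + 1) (by omega) (by omega)
          omega) z hcon
      exact hz (r + 1) (by omega) hr ⟨hinf, tendsto_infDist_of_headSum_tailSum (hunit z hinf)
        ((ih (by omega)).mono_left hinf.le_comap) htail⟩
  have hbound : ∀ z ∈ kSet k f P l (i - 1), ∃ c : ℝ, 0 < c ∧ ∀ n : ℕ,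
      ‖f^[n] z‖ ≤ c ^ ((d i : ℝ) ^ n) * max (‖z‖ ^ ((d i : ℝ) ^ n)) 1 := by
    intro z hz
    obtain ⟨C, hC, hstep⟩ := exists_norm_iterate_succ_le hf (hregular (i - 1) (by omega))
      (D := d i) (fun j hj => by
        have := hdegle (i - 1) (by omega) j hj
        rwa [Nat.sub_add_cancel hi1] at this) z (hsmall z hz (i - 1) le_rfl)
    refine ⟨C, by linarith, fun n => ?_⟩
    have h1 := le_pow_pow_of_succ_le (a := fun n => ‖f^[n] z‖) hC hdi hstep n
    have h2 : ‖f^[n] z‖ ≤ C * max ‖f^[n] z‖ 1 :=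
      (le_max_left _ _).trans (le_mul_of_one_le_left (by positivity) hC)
    refine (h2.trans h1).trans (le_of_eq ?_)
    rw [mul_pow, ← Nat.cast_pow, Real.rpow_natCast, Real.rpow_natCast]
    congr 1
    have hmono : MonotoneOn (fun x : ℝ => x ^ d i ^ n) (Set.Ici 0) :=
      fun x hx y _ hxy => pow_le_pow_left₀ hx hxy _
    have := hmono.map_max (norm_nonneg z) (zero_le_one' ℝ)
    simpa using this
  have hliminf : ∀ z, (∃ c : ℝ, 0 < c ∧ ∀ n : ℕ,
      ‖f^[n] z‖ ≤ c ^ ((d i : ℝ) ^ n) * max (‖z‖ ^ ((d i : ℝ) ^ n)) 1) →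
      Filter.liminf
        (fun n : ℕ => ((((d i : ℝ) ^ n)⁻¹ * logPlus ‖f^[n] z‖ : ℝ) : EReal)) atTop < ⊤ := by
    rintro z ⟨c, hc, hle⟩
    set B := Real.log (max c 1 * max ‖z‖ 1) with hB
    have hM : 1 ≤ max c 1 * max ‖z‖ 1 :=
      one_le_mul_of_one_le_of_one_le (le_max_right _ _) (le_max_right _ _)
    have hbd : ∀ n : ℕ, ((d i : ℝ) ^ n)⁻¹ * logPlus ‖f^[n] z‖ ≤ B := by
      intro n
      have hdn : (0 : ℝ) < (d i : ℝ) ^ n := by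
        have : (0 : ℝ) < d i := by exact_mod_cast (by omega : 0 < d i)
        positivity
      rw [inv_mul_le_iff₀ hdn]
      refine max_le ?_ (mul_nonneg hdn.le (Real.log_nonneg hM))
      rcases (norm_nonneg (f^[n] z)).eq_or_lt with h0 | h0
      · rw [← h0, Real.log_zero]
        exact mul_nonneg hdn.le (Real.log_nonneg hM)
      rw [hB, ← Real.log_rpow (by linarith)]
      refine Real.log_le_log h0 ((hle n).trans ?_)
      rw [Real.mul_rpow (by positivity) (by positivity)]
      gcongr
      · exact le_max_left _ _
      · refine max_le (Real.rpow_le_rpow (norm_nonneg z) (le_max_left _ _) hdn.le) ?_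
        exact Real.one_le_rpow (le_max_right _ _) hdn.le
    refine lt_of_le_of_lt (liminf_le_of_le (a := (B : EReal)) (by isBoundedDefault) fun b hb => ?_)
      (EReal.coe_lt_top B)
    obtain ⟨n, hn⟩ := hb.exists
    exact hn.trans (EReal.coe_le_coe_iff.2 (hbd n))
  have hback : ∀ z, Filter.liminf
        (fun n : ℕ => ((((d i : ℝ) ^ n)⁻¹ * logPlus ‖f^[n] z‖ : ℝ) : EReal)) atTop < ⊤ →
      z ∈ kSet k f P l (i - 1) := by
    intro z hz
    by_contra hcon
    have := (EReal.tendsto_coe_nhds_top_iff.2 (hnot z hcon)).liminf_eq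
    exact hz.ne this
  exact ⟨Set.Subset.antisymm (fun z hz => hliminf z (hbound z hz)) hback,
    Set.Subset.antisymm hbound (fun z hz => hback z (hliminf z hz)), hnot⟩
end

section
/- Assume σ < 0 and {z ∈ ℂ² : P_1^{D_1}(z) = P_2^{D_2}(z) = 0} = {0}. Write σ = −p_1/p_2 with p_1, p_2 coprime positive integers (so p_1 ≤ p_2). Then f is π-regular for π(z) = (z_1^{p_1}, z_2^{p_2}); in particular f is semi-regular. -/
open MvPolynomial Classical

noncomputable section

/-- The slope `σ`: the minimum of `n/(m − d₁)` over the pairs `(m,n) ≠ (d₁,0)` in the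
supports of `P₁` and `P₂`. -/
def slopeSigma (P1 P2 : MvPolynomial (Fin 2) ℂ) (d1 : ℕ) : ℝ :=
  sInf {x : ℝ | ∃ s : Fin 2 →₀ ℕ, (s ∈ P1.support ∨ s ∈ P2.support) ∧
    ¬(s 0 = d1 ∧ s 1 = 0) ∧ x = (s 1 : ℝ) / ((s 0 : ℝ) - (d1 : ℝ))}

/-- The truncation `P^D` of `P` to the line `D = {(x,y) : y − σ·x = b}`: the sum of
the monomials `c_{mn} z₁^m z₂^n` of `P` with `(m,n) ∈ D`. -/
def lineTrunc (P : MvPolynomial (Fin 2) ℂ) (σ b : ℝ) : MvPolynomial (Fin 2) ℂ :=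
  ∑ s ∈ P.support.filter (fun s => (s 1 : ℝ) - σ * (s 0 : ℝ) = b),
    monomial s (coeff s P)

/-- The height of the supporting line `D₂` of slope `σ` of the Newton polygon of
`P₂` (so that `D₂` has `Σ₂` on or below it and meets `Σ₂`). -/
def bD2 (P2 : MvPolynomial (Fin 2) ℂ) (σ : ℝ) : ℝ :=
  sSup {x : ℝ | ∃ s ∈ P2.support, x = (s 1 : ℝ) - σ * (s 0 : ℝ)}

/-- `(Q₁, Q₂)` is a regular polynomial map of `ℂ²`: `deg Q₁ ≥ deg Q₂ ≥ 1`, the top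
homogeneous parts have no common zero but `0`, and if `deg Q₁ > deg Q₂` the
coefficient of `z₁^{deg Q₁}` in `Q₁` is nonzero. -/
def Regular2 (Q1 Q2 : MvPolynomial (Fin 2) ℂ) : Prop :=
  Q2.totalDegree ≤ Q1.totalDegree ∧ 1 ≤ Q2.totalDegree ∧
  {z : Fin 2 → ℂ | eval z (homogeneousComponent Q1.totalDegree Q1) = 0 ∧
    eval z (homogeneousComponent Q2.totalDegree Q2) = 0} = {0} ∧
  (Q2.totalDegree < Q1.totalDegree →
    coeff (Finsupp.single (0 : Fin 2) Q1.totalDegree) Q1 ≠ 0)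

end

/-- The exponent of `z₁^m z₂^n` after the substitution `(z₁^{p₁}, z₂^{p₂})`. -/
noncomputable def scaleExp (p1 p2 : ℕ) (s : Fin 2 →₀ ℕ) : Fin 2 →₀ ℕ :=
  Finsupp.single 0 (p1 * s 0) + Finsupp.single 1 (p2 * s 1)

@[simp]
lemma scaleExp_zero (p1 p2 : ℕ) (s : Fin 2 →₀ ℕ) : scaleExp p1 p2 s 0 = p1 * s 0 := by
  simp [scaleExp]

@[simp]
lemma scaleExp_one (p1 p2 : ℕ) (s : Fin 2 →₀ ℕ) : scaleExp p1 p2 s 1 = p2 * s 1 := by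
  simp [scaleExp]

lemma degree_fin_two (s : Fin 2 →₀ ℕ) : s.degree = s 0 + s 1 := by
  simp [Finsupp.degree_eq_sum]

lemma scaleExp_injective {p1 p2 : ℕ} (hp1 : 0 < p1) (hp2 : 0 < p2) :
    Function.Injective (scaleExp p1 p2) := by
  intro s t h
  have h0 := DFunLike.congr_fun h 0
  have h1 := DFunLike.congr_fun h 1
  simp only [scaleExp_zero, scaleExp_one] at h0 h1
  ext i
  fin_cases i
  · exact Nat.eq_of_mul_eq_mul_left hp1 h0
  · exact Nat.eq_of_mul_eq_mul_left hp2 h1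

lemma aeval_pow_eq_sum (p1 p2 : ℕ) (P : MvPolynomial (Fin 2) ℂ) :
    aeval (![X 0 ^ p1, X 1 ^ p2] : Fin 2 → MvPolynomial (Fin 2) ℂ) P =
      ∑ s ∈ P.support, monomial (scaleExp p1 p2 s) (coeff s P) := by
  rw [aeval_def, eval₂_eq']
  refine Finset.sum_congr rfl fun s _ => ?_
  simp [Fin.prod_univ_two, monomial_eq, scaleExp, Finsupp.prod_fintype, ← pow_mul,
    algebraMap_eq]

lemma coeff_scaleExp_aeval_pow {p1 p2 : ℕ} (hp1 : 0 < p1) (hp2 : 0 < p2)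
    (P : MvPolynomial (Fin 2) ℂ) (s : Fin 2 →₀ ℕ) :
    coeff (scaleExp p1 p2 s)
      (aeval (![X 0 ^ p1, X 1 ^ p2] : Fin 2 → MvPolynomial (Fin 2) ℂ) P) = coeff s P := by
  rw [aeval_pow_eq_sum]
  simp [coeff_sum, coeff_monomial, (scaleExp_injective hp1 hp2).eq_iff, eq_comm]

/-- The degree of `P(z₁^{p₁}, z₂^{p₂})` is the maximal weight `p₁m + p₂n` on the support. -/
lemma totalDegree_aeval_pow {p1 p2 : ℕ} (hp1 : 0 < p1) (hp2 : 0 < p2)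
    {P : MvPolynomial (Fin 2) ℂ} {s : Fin 2 →₀ ℕ} (hs : s ∈ P.support)
    (hmax : ∀ t ∈ P.support, p1 * t 0 + p2 * t 1 ≤ p1 * s 0 + p2 * s 1) :
    (aeval (![X 0 ^ p1, X 1 ^ p2] : Fin 2 → MvPolynomial (Fin 2) ℂ) P).totalDegree =
      p1 * s 0 + p2 * s 1 := by
  apply le_antisymm
  · rw [aeval_pow_eq_sum]
    refine totalDegree_finsetSum_le fun t ht => ?_
    refine (totalDegree_monomial_le _ _).trans ?_
    change (scaleExp p1 p2 t).degree ≤ _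
    rw [degree_fin_two, scaleExp_zero, scaleExp_one]
    exact hmax t ht
  · have h : scaleExp p1 p2 s ∈
        (aeval (![X 0 ^ p1, X 1 ^ p2] : Fin 2 → MvPolynomial (Fin 2) ℂ) P).support := by
      rw [mem_support_iff, coeff_scaleExp_aeval_pow hp1 hp2]
      exact mem_support_iff.mp hs
    have := le_totalDegree h
    change (scaleExp p1 p2 s).degree ≤ _ at this
    rwa [degree_fin_two, scaleExp_zero, scaleExp_one] at this

/-- A homogeneous component of `P(z₁^{p₁}, z₂^{p₂})` comes from a truncation of `P` to a line of
slope `-p₁/p₂`. -/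
lemma eval_homogeneousComponent_aeval_pow {p1 p2 : ℕ} (hp2 : 0 < p2)
    (P : MvPolynomial (Fin 2) ℂ) (N : ℕ) (z : Fin 2 → ℂ) :
    eval z (homogeneousComponent N
      (aeval (![X 0 ^ p1, X 1 ^ p2] : Fin 2 → MvPolynomial (Fin 2) ℂ) P)) =
      eval ![z 0 ^ p1, z 1 ^ p2] (lineTrunc P (-(p1 : ℝ) / p2) ((N : ℝ) / p2)) := by
  have hp : (p2 : ℝ) ≠ 0 := by positivity
  rw [aeval_pow_eq_sum, lineTrunc, map_sum, map_sum, map_sum, Finset.sum_filter]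
  refine Finset.sum_congr rfl fun s _ => ?_
  have hiff : (s 1 : ℝ) - -(p1 : ℝ) / p2 * s 0 = (N : ℝ) / p2 ↔ p1 * s 0 + p2 * s 1 = N := by
    rw [← Nat.cast_inj (R := ℝ)]
    push_cast
    field_simp
    constructor <;> intro h <;> linarith
  have hmem := isHomogeneous_monomial (R := ℂ) (d := scaleExp p1 p2 s) (coeff s P) rfl
  rw [homogeneousComponent_of_mem hmem, degree_fin_two, scaleExp_zero, scaleExp_one]
  simp only [hiff, eq_comm (a := N)]
  split_ifs
  · simp [eval_monomial, Finsupp.prod_fintype, Fin.prod_univ_two, pow_mul]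
  · simp

lemma add_le_totalDegree {P : MvPolynomial (Fin 2) ℂ} {s : Fin 2 →₀ ℕ} (hs : s ∈ P.support) :
    s 0 + s 1 ≤ P.totalDegree := by
  rw [← degree_fin_two]
  exact le_totalDegree hs

lemma bD2_eq_of_isMax {P : MvPolynomial (Fin 2) ℂ} {p1 p2 : ℕ} (hp2 : 0 < p2)
    {s : Fin 2 →₀ ℕ} (hs : s ∈ P.support)
    (hmax : ∀ t ∈ P.support, p1 * t 0 + p2 * t 1 ≤ p1 * s 0 + p2 * s 1) :
    bD2 P (-(p1 : ℝ) / p2) = ((p1 * s 0 + p2 * s 1 : ℕ) : ℝ) / p2 := by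
  have hp : (0 : ℝ) < p2 := by positivity
  have hw (t : Fin 2 →₀ ℕ) :
      (t 1 : ℝ) - -(p1 : ℝ) / p2 * t 0 = ((p1 * t 0 + p2 * t 1 : ℕ) : ℝ) / p2 := by
    push_cast
    field_simp
    ring
  refine IsGreatest.csSup_eq ⟨⟨s, hs, (hw s).symm⟩, ?_⟩
  rintro _ ⟨t, ht, rfl⟩
  rw [hw]
  have := hmax t ht
  gcongr

/-- The slope of the line through `(d₁,0)` and another point of the triangle `m + n ≤ d₁` is
at least `-1`. -/
lemma neg_one_le_slope {d1 m n : ℕ} (h : m + n ≤ d1) (hne : ¬(m = d1 ∧ n = 0)) :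
    m < d1 ∧ (-1 : ℝ) ≤ (n : ℝ) / ((m : ℝ) - d1) := by
  have hm : m < d1 := by omega
  have h' : (m : ℝ) + n ≤ d1 := by exact_mod_cast h
  have hm' : (m : ℝ) < d1 := by exact_mod_cast hm
  refine ⟨hm, ?_⟩
  rw [le_div_iff_of_neg (by linarith)]
  linarith

/-- (Proposition 3.1, sufficiency.) Let `f = (P₁,P₂)` be
algebraically stable with `deg P₁ = d₁ > deg P₂ = d₂ ≥ 1`. If the slope `σ` of the
supporting line `D₁` is negative and the truncations `P₁^{D₁}`, `P₂^{D₂}` have no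
common zero but `0`, then writing `σ = −p₁/p₂` in lowest terms, `f` is `π`-regular
for `π(z) = (z₁^{p₁}, z₂^{p₂})`; in particular `f` is semi-regular. -/
theorem stmt10 (P1 P2 : MvPolynomial (Fin 2) ℂ) (hP2 : P2 ≠ 0)
    (d1 d2 : ℕ) (hd1 : P1.totalDegree = d1) (hd2 : P2.totalDegree = d2)
    (hdd : d2 < d1) (hd21 : 1 ≤ d2)
    (hstable : coeff (Finsupp.single (0 : Fin 2) d1) P1 ≠ 0)
    (hσneg : slopeSigma P1 P2 d1 < 0)
    (hzero : {z : Fin 2 → ℂ |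
        eval z (lineTrunc P1 (slopeSigma P1 P2 d1) (-(slopeSigma P1 P2 d1) * (d1 : ℝ))) = 0 ∧
        eval z (lineTrunc P2 (slopeSigma P1 P2 d1) (bD2 P2 (slopeSigma P1 P2 d1))) = 0}
      = {0})
    (p1 p2 : ℕ) (hp1 : 0 < p1) (hp2 : 0 < p2) (hcop : Nat.Coprime p1 p2)
    (hslope : slopeSigma P1 P2 d1 = -(p1 : ℝ) / (p2 : ℝ))
    (π : Fin 2 → MvPolynomial (Fin 2) ℂ)
    (hπ : π = ![X 0 ^ p1, X 1 ^ p2]) :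
    p1 ≤ p2 ∧ Regular2 (aeval π P1) (aeval π P2) := by
  subst hπ hd1 hd2
  set d1 := P1.totalDegree with hd1
  have htri : ∀ s : Fin 2 →₀ ℕ, (s ∈ P1.support ∨ s ∈ P2.support) → s 0 + s 1 ≤ d1 := by
    rintro s (hs | hs)
    · exact add_le_totalDegree hs
    · exact (add_le_totalDegree hs).trans hdd.le
  have hp2' : (0 : ℝ) < p2 := by positivity
  have hbound : ∀ s : Fin 2 →₀ ℕ, (s ∈ P1.support ∨ s ∈ P2.support) →
      p1 * s 0 + p2 * s 1 ≤ p1 * d1 := by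
    intro s hs
    by_cases hne : s 0 = d1 ∧ s 1 = 0
    · simp [hne]
    · have hle : slopeSigma P1 P2 d1 ≤ (s 1 : ℝ) / ((s 0 : ℝ) - d1) := by
        refine csInf_le ⟨-1, ?_⟩ ⟨s, hs, hne, rfl⟩
        rintro _ ⟨t, ht, htne, rfl⟩
        exact (neg_one_le_slope (htri t ht) htne).2
      have hlt : (s 0 : ℝ) < d1 := by exact_mod_cast (neg_one_le_slope (htri s hs) hne).1
      rw [hslope, le_div_iff_of_neg (by linarith), div_mul_eq_mul_div, le_div_iff₀ hp2'] at hle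
      have : (p1 : ℝ) * s 0 + p2 * s 1 ≤ p1 * d1 := by linarith
      exact_mod_cast this
  have hp12 : p1 ≤ p2 := by
    obtain ⟨s, hs⟩ := support_nonempty.mpr hP2
    have hs0 : s 0 < d1 := by
      have := add_le_totalDegree hs
      omega
    have hle : -1 ≤ slopeSigma P1 P2 d1 := by
      refine le_csInf ⟨_, s, Or.inr hs, fun h => hs0.ne h.1, rfl⟩ ?_
      rintro _ ⟨t, ht, htne, rfl⟩
      exact (neg_one_le_slope (htri t ht) htne).2
    rw [hslope, le_div_iff₀ hp2'] at hle
    have : (p1 : ℝ) ≤ p2 := by linarith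
    exact_mod_cast this
  have hmem1 : Finsupp.single (0 : Fin 2) d1 ∈ P1.support := mem_support_iff.mpr hstable
  have hdeg1 := totalDegree_aeval_pow hp1 hp2 hmem1 fun t ht => by
    simpa using hbound t (Or.inl ht)
  simp only [Finsupp.single_eq_same, ne_eq, one_ne_zero, not_false_eq_true,
    Finsupp.single_eq_of_ne, mul_zero, add_zero] at hdeg1
  obtain ⟨s, hs, hmax⟩ := P2.support.exists_max_image (fun t => p1 * t 0 + p2 * t 1)
    (support_nonempty.mpr hP2)
  have hdeg2 := totalDegree_aeval_pow hp1 hp2 hs hmax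
  have hpos : 1 ≤ p1 * s 0 + p2 * s 1 := by
    obtain ⟨t, ht, hdt⟩ := P2.support.exists_mem_eq_sup (support_nonempty.mpr hP2)
      fun t => t.degree
    have hdt' : P2.totalDegree = t 0 + t 1 := by
      rw [← degree_fin_two]
      exact hdt
    have h1 := hmax t ht
    have h2 := Nat.le_mul_of_pos_left (t 0) hp1
    have h3 := Nat.le_mul_of_pos_left (t 1) hp2
    omega
  refine ⟨hp12, ?_, ?_, ?_, ?_⟩
  · rw [hdeg1, hdeg2]
    exact hbound s (Or.inr hs)
  · rwa [hdeg2]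
  · have hb1 : -(-(p1 : ℝ) / p2) * (d1 : ℝ) = ((p1 * d1 : ℕ) : ℝ) / p2 := by
      push_cast
      ring
    rw [hslope, hb1, bD2_eq_of_isMax hp2 hs hmax] at hzero
    ext z
    have hz := Set.ext_iff.mp hzero ![z 0 ^ p1, z 1 ^ p2]
    rw [hdeg1, hdeg2]
    simp only [Set.mem_ofPred_eq, eval_homogeneousComponent_aeval_pow hp2] at hz ⊢
    rw [hz]
    simp [_root_.funext_iff, Fin.forall_fin_two, hp1.ne', hp2.ne']
  · intro _
    have : Finsupp.single (0 : Fin 2) (p1 * d1) = scaleExp p1 p2 (Finsupp.single 0 d1) := by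
      simp [scaleExp]
    rw [hdeg1, this, coeff_scaleExp_aeval_pow hp1 hp2]
    exact hstable
end
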